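/- Let G be a coalition with ∅ ≠ G ≠ N, let Y = {α,β,γ} ⊆ X be a set of three distinct alternatives, and let F be an SWF on a domain D satisfying unanimity and IIA. Assume D_1(G,Y) ⊆ D|_Y. Then for all distinct a,b,c ∈ Y: (1) for every profile P ∈ D such that for all i, (a P_i c iff i ∈ G) and (b P_i a iff i ∉ G), it is not the case that F(P) ranks both c above a and a above b; (2) for every profile P ∈ D such that for all i, (a P_i c iff i ∉ G) and (b P_i a iff i ∈ G), it is not the case that F(P) ranks both a above c and b above a. -/

import Mathlib

open Set
namespace ArrowSC

/-- A profile assigns to each voter a binary relation (their preference) on alternatives. -/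
abbrev Profile (n : ℕ) (X : Type*) := Fin n → X → X → Prop

/-- `r` is a strict total order. -/
def IsSTO {X : Type*} (r : X → X → Prop) : Prop :=
  (∀ x, ¬ r x x) ∧ (∀ x y z, r x y → r y z → r x z) ∧
  (∀ x y, x ≠ y → r x y ∨ r y x)

/-- A genuine profile: every voter's relation is a strict total order, i.e. a member of W(X)^n. -/
def IsProfile {n : ℕ} {X : Type*} (P : Profile n X) : Prop := ∀ i, IsSTO (P i)

/-- A domain: a nonempty set of profiles, each a member of W(X)^n. -/
def IsDomain {n : ℕ} {X : Type*} (D : Set (Profile n X)) : Prop :=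
  D.Nonempty ∧ ∀ P ∈ D, IsProfile P

/-- `F` is a social welfare function on `D`: it sends each profile in `D` to a strict total order. -/
def IsSWF {n : ℕ} {X : Type*} (D : Set (Profile n X))
    (F : Profile n X → X → X → Prop) : Prop :=
  ∀ P ∈ D, IsSTO (F P)

def Unanimity {n : ℕ} {X : Type*} (D : Set (Profile n X))
    (F : Profile n X → X → X → Prop) : Prop :=
  ∀ P ∈ D, ∀ a b : X, (∀ i, P i a b) → F P a b

def IIA {n : ℕ} {X : Type*} (D : Set (Profile n X))
    (F : Profile n X → X → X → Prop) : Prop :=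
  ∀ P ∈ D, ∀ P' ∈ D, ∀ a b : X, (∀ i, P i a b ↔ P' i a b) → (F P a b ↔ F P' a b)

def IsDictator {n : ℕ} {X : Type*} (D : Set (Profile n X))
    (F : Profile n X → X → X → Prop) (d : Fin n) : Prop :=
  ∀ P ∈ D, ∀ a b : X, P d a b → F P a b

def Dictatorial {n : ℕ} {X : Type*} (D : Set (Profile n X))
    (F : Profile n X → X → X → Prop) : Prop :=
  ∃ d, IsDictator D F d

/-- Coalition `G` is almost-decisive over the ordered pair `(a, b)` w.r.t. `F`. -/
def AlmostDecisivePair {n : ℕ} {X : Type*} (D : Set (Profile n X))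
    (F : Profile n X → X → X → Prop) (G : Set (Fin n)) (a b : X) : Prop :=
  ∀ P ∈ D, (∀ i, P i a b ↔ i ∈ G) → F P a b

/-- Coalition `G` is almost-decisive over `Y` w.r.t. `F`. -/
def AlmostDecisiveOn {n : ℕ} {X : Type*} (D : Set (Profile n X))
    (F : Profile n X → X → X → Prop) (G : Set (Fin n)) (Y : Set X) : Prop :=
  ∀ a ∈ Y, ∀ b ∈ Y, a ≠ b → AlmostDecisivePair D F G a b

/-- Coalition `G` is almost-decisive (over all of X) w.r.t. `F`. -/
def AlmostDecisive {n : ℕ} {X : Type*} (D : Set (Profile n X))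
    (F : Profile n X → X → X → Prop) (G : Set (Fin n)) : Prop :=
  ∀ a b : X, a ≠ b → AlmostDecisivePair D F G a b

/-- The restriction of `r` to the triple `{a,b,c}` is the order `a` above `b` above `c`. -/
def RanksTriple {X : Type*} (r : X → X → Prop) (a b c : X) : Prop :=
  r a b ∧ r b c ∧ r a c

/-- The polarized profile `(G : abc, Gᶜ : a'b'c')` on a triple is a subprofile of `D`,
i.e. it belongs to the restriction `D|_{triple}`. -/
def HasPolarizedSubprofile {n : ℕ} {X : Type*} (D : Set (Profile n X)) (G : Set (Fin n))
    (a b c a' b' c' : X) : Prop :=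
  ∃ P ∈ D, ∀ i, (i ∈ G → RanksTriple (P i) a b c) ∧ (i ∉ G → RanksTriple (P i) a' b' c')

/-- `D_1(G, {a,b,c}) ⊆ D|_{{a,b,c}}`. -/
def D1sub {n : ℕ} {X : Type*} (D : Set (Profile n X)) (G : Set (Fin n)) (a b c : X) : Prop :=
  HasPolarizedSubprofile D G b c a a b c ∧
  HasPolarizedSubprofile D G b a c a c b ∧
  HasPolarizedSubprofile D G a b c c a b ∧
  HasPolarizedSubprofile D G a c b c b a ∧
  HasPolarizedSubprofile D G c a b b c a ∧
  HasPolarizedSubprofile D G c b a b a c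

/-- `D_2(G, {a,b,c}) ⊆ D|_{{a,b,c}}`. -/
def D2sub {n : ℕ} {X : Type*} (D : Set (Profile n X)) (G : Set (Fin n)) (a b c : X) : Prop :=
  HasPolarizedSubprofile D G a b c b c a ∧
  HasPolarizedSubprofile D G a c b b a c ∧
  HasPolarizedSubprofile D G c a b a b c ∧
  HasPolarizedSubprofile D G c b a a c b ∧
  HasPolarizedSubprofile D G b c a c a b ∧
  HasPolarizedSubprofile D G b a c c b a

/-- The class 𝒟^PT of polarization over triples. -/
def ClassPT {n : ℕ} {X : Type*} (D : Set (Profile n X)) : Prop :=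
  ∀ G : Set (Fin n), G ≠ ∅ → G ≠ univ →
    ∀ a b c : X, a ≠ b → b ≠ c → a ≠ c →
      D1sub D G a b c ∨ D2sub D G a b c

/-- The class 𝒟^DT of diversity over triples. -/
def ClassDT {n : ℕ} {X : Type*} (D : Set (Profile n X)) : Prop :=
  ∀ G G' : Set (Fin n), ¬ G ⊆ G' → ¬ G' ⊆ G →
    ∃ a b c : X, a ≠ b ∧ b ≠ c ∧ a ≠ c ∧ ∃ P ∈ D, ∀ i,
      (P i a b ↔ i ∈ G) ∧ (P i b c ↔ i ∈ G') ∧ (P i c a ↔ i ∉ G ∩ G')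

/-- `D` is Arrow-inconsistent. -/
def ArrowInconsistent {n : ℕ} {X : Type*} (D : Set (Profile n X)) : Prop :=
  ∀ F : Profile n X → X → X → Prop,
    IsSWF D F → Unanimity D F → IIA D F → Dictatorial D F

/-- `a` is the most-preferred among `{a,b,c}` according to `r`. -/
def TripleBest {X : Type*} (r : X → X → Prop) (a b c : X) : Prop := r a b ∧ r a c

/-- `a` is the least-preferred among `{a,b,c}` according to `r`. -/
def TripleWorst {X : Type*} (r : X → X → Prop) (a b c : X) : Prop := r b a ∧ r c a

/-- `a` is the middle-preferred among `{a,b,c}` according to `r`. -/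
def TripleMiddle {X : Type*} (r : X → X → Prop) (a b c : X) : Prop :=
  (r b a ∧ r a c) ∨ (r c a ∧ r a b)

/-- In profile `P`, alternative `a` is never placed as the most-preferred, or never as the
middle-preferred, or never as the least-preferred alternative among `{a,b,c}`. -/
def NeverBMW {n : ℕ} {X : Type*} (P : Profile n X) (a b c : X) : Prop :=
  (∀ i, ¬ TripleBest (P i) a b c) ∨ (∀ i, ¬ TripleMiddle (P i) a b c) ∨
  (∀ i, ¬ TripleWorst (P i) a b c)

/-- Sen's value-restriction of a profile over `Y`. -/
def ValueRestricted {n : ℕ} {X : Type*} (P : Profile n X) (Y : Set X) : Prop :=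
  ∀ a ∈ Y, ∀ b ∈ Y, ∀ c ∈ Y, a ≠ b → b ≠ c → a ≠ c →
    NeverBMW P a b c ∨ NeverBMW P b a c ∨ NeverBMW P c a b

/-- The strict total order on the triple `{a,b,c}` ranking `a` above `b` above `c`,
viewed as a relation with support in `{a,b,c}`. -/
def seqOrder {X : Type*} (a b c : X) : X → X → Prop :=
  fun x y => (x = a ∧ y = b) ∨ (x = b ∧ y = c) ∨ (x = a ∧ y = c)

/-- `r` is a strict total order on the triple `{a,b,c}` (with support in the triple). -/
def IsTripleOrder {X : Type*} (a b c : X) (r : X → X → Prop) : Prop :=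
  (∀ x y, r x y → x ∈ ({a, b, c} : Set X) ∧ y ∈ ({a, b, c} : Set X)) ∧
  (∀ x, ¬ r x x) ∧ (∀ x y z, r x y → r y z → r x z) ∧
  (∀ x ∈ ({a, b, c} : Set X), ∀ y ∈ ({a, b, c} : Set X), x ≠ y → r x y ∨ r y x)

/-- The polarized profile `(G : Q, Gᶜ : Q')`. -/
def polarizedProfile {n : ℕ} {X : Type*} (G : Set (Fin n)) (Q Q' : X → X → Prop) :
    Profile n X :=
  fun i x y => (i ∈ G ∧ Q x y) ∨ (i ∉ G ∧ Q' x y)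

/-- `Q` and `Q'` differ on how they rank the pair `{x, y}`. -/
def DifferOn {X : Type*} (Q Q' : X → X → Prop) (x y : X) : Prop := ¬ (Q x y ↔ Q' x y)

/-- `Q` and `Q'` differ on exactly two of the three unordered pairs of the triple `{a,b,c}`
and coincide on the remaining pair. -/
def StronglyPolarizedPair {X : Type*} (a b c : X) (Q Q' : X → X → Prop) : Prop :=
  (DifferOn Q Q' a b ∧ DifferOn Q Q' b c ∧ ¬ DifferOn Q Q' a c) ∨
  (DifferOn Q Q' a b ∧ ¬ DifferOn Q Q' b c ∧ DifferOn Q Q' a c) ∨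
  (¬ DifferOn Q Q' a b ∧ DifferOn Q Q' b c ∧ DifferOn Q Q' a c)

/-- The set `D_1(G, {a,b,c})` of polarized profiles on the triple `{a,b,c}`. -/
def D1set {n : ℕ} {X : Type*} (G : Set (Fin n)) (a b c : X) : Set (Profile n X) :=
  { polarizedProfile G (seqOrder b c a) (seqOrder a b c),
    polarizedProfile G (seqOrder b a c) (seqOrder a c b),
    polarizedProfile G (seqOrder a b c) (seqOrder c a b),
    polarizedProfile G (seqOrder a c b) (seqOrder c b a),
    polarizedProfile G (seqOrder c a b) (seqOrder b c a),
    polarizedProfile G (seqOrder c b a) (seqOrder b a c) }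

/-- The set `D_2(G, {a,b,c})` of polarized profiles on the triple `{a,b,c}`. -/
def D2set {n : ℕ} {X : Type*} (G : Set (Fin n)) (a b c : X) : Set (Profile n X) :=
  { polarizedProfile G (seqOrder a b c) (seqOrder b c a),
    polarizedProfile G (seqOrder a c b) (seqOrder b a c),
    polarizedProfile G (seqOrder c a b) (seqOrder a b c),
    polarizedProfile G (seqOrder c b a) (seqOrder a c b),
    polarizedProfile G (seqOrder b c a) (seqOrder c a b),
    polarizedProfile G (seqOrder b a c) (seqOrder c b a) }

/-- The set of all strongly polarized profiles on the triple `{a,b,c}`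
of the form `(G : Q, Gᶜ : Q')`. -/
def SPset {n : ℕ} {X : Type*} (G : Set (Fin n)) (a b c : X) : Set (Profile n X) :=
  { p | ∃ Q Q', IsTripleOrder a b c Q ∧ IsTripleOrder a b c Q' ∧
      StronglyPolarizedPair a b c Q Q' ∧ p = polarizedProfile G Q Q' }
theorem IsSTO.asymm {X : Type*} {r : X → X → Prop} (h : IsSTO r) {a b : X} (hab : r a b) :
    ¬ r b a :=
  fun hba => h.1 a (h.2.1 a b a hab hba)

theorem IsSTO.not_iff {X : Type*} {r : X → X → Prop} (h : IsSTO r) {a b : X} (hab : a ≠ b) :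
    ¬ r a b ↔ r b a :=
  ⟨(h.2.2 a b hab).resolve_left, fun hba => h.asymm hba⟩

/-- Under IIA, a coalition that prevails once on `(a, b)` against everyone else is almost-decisive
over `(a, b)`. -/
theorem IIA.almostDecisivePair {n : ℕ} {X : Type*} {D : Set (Profile n X)}
    {F : Profile n X → X → X → Prop} (hIIA : IIA D F) {G : Set (Fin n)} {a b : X}
    {P : Profile n X} (hP : P ∈ D) (hG : ∀ i, P i a b ↔ i ∈ G) (h : F P a b) :
    AlmostDecisivePair D F G a b :=
  fun P' hP' hG' => (hIIA P hP P' hP' a b fun i => (hG i).trans (hG' i).symm).1 h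

/-- The subprofile `(G : uvw, Gᶜ : wuv)` transfers almost-decisiveness from `(v, w)` to
`(u, w)`. -/
theorem AlmostDecisivePair.of_top_moved_down {n : ℕ} {X : Type*} {D : Set (Profile n X)}
    {F : Profile n X → X → X → Prop} {G : Set (Fin n)} {u v w : X} (hD : IsDomain D)
    (hF : IsSWF D F) (hU : Unanimity D F) (hIIA : IIA D F)
    (hP : HasPolarizedSubprofile D G u v w w u v) (h : AlmostDecisivePair D F G v w) :
    AlmostDecisivePair D F G u w := by
  obtain ⟨P, hPD, hP⟩ := hP
  have huv : ∀ i, P i u v := fun i => by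
    by_cases hi : i ∈ G
    exacts [((hP i).1 hi).1, ((hP i).2 hi).2.1]
  have hvw : ∀ i, P i v w ↔ i ∈ G := fun i =>
    ⟨fun hi => by_contra fun hG => (hD.2 P hPD i).asymm hi ((hP i).2 hG).2.2,
      fun hG => ((hP i).1 hG).2.1⟩
  have huw : ∀ i, P i u w ↔ i ∈ G := fun i =>
    ⟨fun hi => by_contra fun hG => (hD.2 P hPD i).asymm hi ((hP i).2 hG).1,
      fun hG => ((hP i).1 hG).2.2⟩
  exact hIIA.almostDecisivePair hPD huw
    ((hF P hPD).2.1 u v w (hU P hPD u v huv) (h P hPD hvw))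

/-- The subprofile `(G : uvw, Gᶜ : vwu)` transfers almost-decisiveness from `(u, v)` to
`(u, w)`. -/
theorem AlmostDecisivePair.of_top_moved_up {n : ℕ} {X : Type*} {D : Set (Profile n X)}
    {F : Profile n X → X → X → Prop} {G : Set (Fin n)} {u v w : X} (hD : IsDomain D)
    (hF : IsSWF D F) (hU : Unanimity D F) (hIIA : IIA D F)
    (hP : HasPolarizedSubprofile D G u v w v w u) (h : AlmostDecisivePair D F G u v) :
    AlmostDecisivePair D F G u w := by
  obtain ⟨P, hPD, hP⟩ := hP
  have hvw : ∀ i, P i v w := fun i => by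
    by_cases hi : i ∈ G
    exacts [((hP i).1 hi).2.1, ((hP i).2 hi).1]
  have huv : ∀ i, P i u v ↔ i ∈ G := fun i =>
    ⟨fun hi => by_contra fun hG => (hD.2 P hPD i).asymm hi ((hP i).2 hG).2.2,
      fun hG => ((hP i).1 hG).1⟩
  have huw : ∀ i, P i u w ↔ i ∈ G := fun i =>
    ⟨fun hi => by_contra fun hG => (hD.2 P hPD i).asymm hi ((hP i).2 hG).2.1,
      fun hG => ((hP i).1 hG).2.2⟩
  exact hIIA.almostDecisivePair hPD huw
    ((hF P hPD).2.1 u v w (h P hPD huv) (hU P hPD v w hvw))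

/-- The six subprofiles of `D_1(G, {x, y, z})` transfer almost-decisiveness of `G` around the cycle
`(z, x), (y, x), (y, z), (x, z), (x, y), (z, y)`, hence from any pair to the whole triple. -/
theorem AlmostDecisivePair.almostDecisiveOn_of_D1sub {n : ℕ} {X : Type*} {D : Set (Profile n X)}
    {F : Profile n X → X → X → Prop} {G : Set (Fin n)} {x y z a b : X} (hD : IsDomain D)
    (hF : IsSWF D F) (hU : Unanimity D F) (hIIA : IIA D F) (h1 : D1sub D G x y z)
    (ha : a ∈ ({x, y, z} : Set X)) (hb : b ∈ ({x, y, z} : Set X)) (hab : a ≠ b)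
    (h : AlmostDecisivePair D F G a b) : AlmostDecisiveOn D F G {x, y, z} := by
  obtain ⟨p₁, p₂, p₃, p₄, p₅, p₆⟩ := h1
  have zx_yx := of_top_moved_down hD hF hU hIIA p₁
  have yx_yz := of_top_moved_up hD hF hU hIIA p₂
  have yz_xz := of_top_moved_down hD hF hU hIIA p₃
  have xz_xy := of_top_moved_up hD hF hU hIIA p₄
  have xy_zy := of_top_moved_down hD hF hU hIIA p₅
  have zy_zx := of_top_moved_up hD hF hU hIIA p₆
  simp only [mem_insert_iff, mem_singleton_iff] at ha hb
  intro c hc d hd hcd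
  simp only [mem_insert_iff, mem_singleton_iff] at hc hd
  have zx : AlmostDecisivePair D F G z x := by
    rcases ha with rfl | rfl | rfl <;> rcases hb with rfl | rfl | rfl <;>
      first
        | exact absurd rfl hab
        | exact h
        | exact zy_zx h
        | exact zy_zx (xy_zy h)
        | exact zy_zx (xy_zy (xz_xy h))
        | exact zy_zx (xy_zy (xz_xy (yz_xz h)))
        | exact zy_zx (xy_zy (xz_xy (yz_xz (yx_yz h))))
  have yx := zx_yx zx
  have yz := yx_yz yx
  have xz := yz_xz yz
  have xy := xz_xy xz
  have zy := xy_zy xy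
  rcases hc with rfl | rfl | rfl <;> rcases hd with rfl | rfl | rfl <;>
    first | exact absurd rfl hcd | assumption

/-- Lemma "not-boundary-1" for `D_1(G, Y)`. -/
theorem not_boundary_one {X : Type*} [Fintype X] {n : ℕ}
    (hX : 3 ≤ Fintype.card X) (hn : 2 ≤ n)
    (D : Set (Profile n X)) (hD : IsDomain D)
    (F : Profile n X → X → X → Prop) (hF : IsSWF D F)
    (hU : Unanimity D F) (hIIA : IIA D F)
    (G : Set (Fin n)) (hGne : G ≠ ∅) (hGuniv : G ≠ univ)
    (x y z : X) (hxy : x ≠ y) (hyz : y ≠ z) (hxz : x ≠ z)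
    (h1 : D1sub D G x y z) :
    ∀ a ∈ ({x, y, z} : Set X), ∀ b ∈ ({x, y, z} : Set X), ∀ c ∈ ({x, y, z} : Set X),
      a ≠ b → b ≠ c → a ≠ c →
      (∀ P ∈ D, (∀ i, (P i a c ↔ i ∈ G) ∧ (P i b a ↔ i ∉ G)) →
        ¬ (F P c a ∧ F P a b)) ∧
      (∀ P ∈ D, (∀ i, (P i a c ↔ i ∉ G) ∧ (P i b a ↔ i ∈ G)) →
        ¬ (F P a c ∧ F P b a)) := by
  intro a ha b hb c hc hab _ hac
  refine ⟨fun P hP hG ⟨hca, hFab⟩ => ?_, fun P hP hG ⟨hFac, hba⟩ => ?_⟩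
  · have hGab : ∀ i, P i a b ↔ i ∈ G := fun i => by
      rw [← (hD.2 P hP i).not_iff hab.symm, (hG i).2, not_not]
    have hdec := (hIIA.almostDecisivePair hP hGab hFab).almostDecisiveOn_of_D1sub
      hD hF hU hIIA h1 ha hb hab
    exact (hF P hP).asymm hca (hdec a ha c hc hac P hP fun i => (hG i).1)
  · have hGca : ∀ i, P i c a ↔ i ∈ G := fun i => by
      rw [← (hD.2 P hP i).not_iff hac, (hG i).1, not_not]
    have hdec := (hIIA.almostDecisivePair hP (fun i => (hG i).2) hba).almostDecisiveOn_of_D1sub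
      hD hF hU hIIA h1 hb ha hab.symm
    exact (hF P hP).asymm hFac (hdec c hc a ha hac.symm P hP hGca)

end ArrowSC
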